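/- (Theorem 4: high-SNR ORA capacity in closed form.) For all real parameters m > 0, γ̄ > 0 and 0 < k < m: ∫₀^∞ log₂(γ) · f(γ) dγ = log₂(γ̄/(k+1)) − 2γ_E/ln 2 + (Γ(m+1)/ln 2) · ∑_{i=0}^∞ ((m)_i / i!) · (k/m)^i · H_i · U(m+i, i, k/m). -/

import Mathlib

open MeasureTheory Set

/-- Pochhammer symbol (rising factorial) `(m)_i = m(m+1)⋯(m+i−1)`. -/
noncomputable def poch (m : ℝ) (i : ℕ) : ℝ := ∏ j ∈ Finset.range i, (m + j)

/-- `n`-th harmonic number `H_n = ∑_{j=1}^n 1/j` (with `H_0 = 0`). -/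
noncomputable def harmonicR (n : ℕ) : ℝ := ∑ j ∈ Finset.range n, 1 / ((j : ℝ) + 1)

/-- Kummer confluent hypergeometric function `₁F₁(m, 1, z) = ∑_{i=0}^∞ ((m)_i/(i!)²) z^i`. -/
noncomputable def kummerM (m z : ℝ) : ℝ :=
  ∑' i : ℕ, poch m i / ((Nat.factorial i : ℝ) ^ 2) * z ^ i

/-- Kummer confluent hypergeometric function of the second kind
`U(a, b, z) = (1/Γ(a)) ∫₀^∞ e^{−zt} t^{a−1} (1+t)^{b−a−1} dt`. -/
noncomputable def kummerU (a b z : ℝ) : ℝ :=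
  (1 / Real.Gamma a) *
    ∫ t in Ioi (0 : ℝ), Real.exp (-z * t) * t ^ (a - 1) * (1 + t) ^ (b - a - 1)

/-- Conditional SNR density of the fdRLoS channel,
`f(γ|x)` with `k_x = k/x`, `γ̄_x = ((k+x)/(k+1))·γ̄`. -/
noncomputable def condPdf (m k γb x γ : ℝ) : ℝ :=
  (m ^ m * (1 + k / x)) / ((m + k / x) ^ m * ((k + x) / (k + 1) * γb)) *
    Real.exp (-((1 + k / x) / ((k + x) / (k + 1) * γb)) * γ) *
    kummerM m ((k / x) * (1 + k / x) / (k / x + m) * (γ / ((k + x) / (k + 1) * γb)))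

/-- Unconditional SNR density of the fdRLoS channel, `f(γ) = ∫₀^∞ f(γ|x) e^{−x} dx`. -/
noncomputable def pdfSNR (m k γb γ : ℝ) : ℝ :=
  ∫ x in Ioi (0 : ℝ), condPdf m k γb x γ * Real.exp (-x)


lemma poch_succ (m : ℝ) (i : ℕ) : poch m (i+1) = poch m i * (m + i) := by
  simp [poch, Finset.prod_range_succ]

lemma poch_pos {m : ℝ} (hm : 0 < m) (i : ℕ) : 0 < poch m i :=
  Finset.prod_pos fun j _ => by positivity

lemma poch_shift (m : ℝ) (i : ℕ) : m * poch (m+1) i = poch m i * (m + i) := by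
  induction i with
  | zero => simp [poch]
  | succ n ih =>
    rw [poch_succ, poch_succ, ← mul_assoc, ih]; push_cast; ring

lemma poch_eq_choose (m : ℝ) (i : ℕ) :
    Ring.choose (m + i - 1) i = poch m i / (Nat.factorial i : ℝ) := by
  have h := Ring.factorial_nsmul_multichoose_eq_ascPochhammer m i
  rw [Ring.multichoose_eq, nsmul_eq_mul, Polynomial.ascPochhammer_smeval_eq_eval] at h
  have h2 : (ascPochhammer ℝ i).eval m = poch m i := by
    clear h
    induction i with
    | zero => simp [poch]
    | succ n ih => rw [ascPochhammer_succ_eval, ih, poch_succ]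
  rw [h2] at h
  rw [eq_div_iff (by positivity), mul_comm]; exact h

lemma negbin (m : ℝ) {q : ℝ} (hq0 : 0 ≤ q) (hq1 : q < 1) :
    HasSum (fun i : ℕ => poch m i / (Nat.factorial i : ℝ) * q ^ i) (((1 - q) ^ m)⁻¹) := by
  have h := (Real.one_div_one_sub_rpow_hasFPowerSeriesOnBall_zero m).hasSum (y := q) (by
    simp [Metric.mem_eball, edist_dist, abs_of_nonneg hq0, hq1])
  simpa [FormalMultilinearSeries.ofScalars, poch_eq_choose] using h

lemma harmonicR_eq (n : ℕ) : ((harmonic n : ℚ) : ℝ) = harmonicR n := by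
  simp [harmonic, harmonicR]

lemma harmonicR_nonneg (n : ℕ) : 0 ≤ harmonicR n :=
  Finset.sum_nonneg fun j _ => by positivity

lemma integral_log_gamma (i : ℕ) :
    ∫ u in Ioi (0:ℝ), Real.log u * (Real.exp (-u) * u ^ i / (Nat.factorial i : ℝ)) =
      harmonicR i - Real.eulerMascheroniConstant := by
  have hs : 0 < ((i:ℂ) + 1).re := by simp; positivity
  have h1 := Complex.hasDerivAt_GammaIntegral hs
  have h2 : HasDerivAt Complex.Gamma (∫ t : ℝ in Ioi 0, (t:ℂ) ^ ((i:ℂ) + 1 - 1) *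
      (Real.log t * Real.exp (-t))) ((i:ℂ)+1) := by
    refine h1.congr_of_eventuallyEq ?_
    have : IsOpen {s : ℂ | 0 < s.re} := isOpen_lt continuous_const Complex.continuous_re
    filter_upwards [this.mem_nhds hs] with a ha using Complex.Gamma_eq_integral ha
  have h3 : (∫ t : ℝ in Ioi 0, (t:ℂ) ^ ((i:ℂ) + 1 - 1) * (Real.log t * Real.exp (-t))) =
      ((∫ u in Ioi (0:ℝ), u ^ i * (Real.log u * Real.exp (-u)) : ℝ) : ℂ) := by
    rw [← integral_complex_ofReal]
    refine setIntegral_congr_fun measurableSet_Ioi fun t ht => ?_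
    simp
  rw [h3] at h2
  have h4 : HasDerivAt Real.Gamma (∫ u in Ioi (0:ℝ), u ^ i * (Real.log u * Real.exp (-u)))
      ((i:ℝ)+1) := by
    have := HasDerivAt.real_of_complex (z := (i:ℝ)+1) (by simpa using h2)
    simpa [Complex.Gamma_ofReal] using this
  have h5 := h4.unique (Real.hasDerivAt_Gamma_nat i)
  rw [harmonicR_eq] at h5
  have : (Nat.factorial i : ℝ) ≠ 0 := by positivity
  calc _ = ∫ u in Ioi (0:ℝ), (u ^ i * (Real.log u * Real.exp (-u))) * ((Nat.factorial i : ℝ))⁻¹ := by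
        congr 1; ext u; field_simp
    _ = _ := by
        rw [integral_mul_const, h5]; field_simp; ring

/-- The gamma density. -/
noncomputable def gd (i : ℕ) (u : ℝ) : ℝ := Real.exp (-u) * u ^ i / (Nat.factorial i : ℝ)

lemma gd_nonneg (i : ℕ) {u : ℝ} (hu : 0 ≤ u) : 0 ≤ gd i u := by unfold gd; positivity

lemma gd_rpow_integrable (i : ℕ) {s : ℝ} (hs : -1 < s) :
    IntegrableOn (fun u => u ^ s * gd i u) (Ioi 0) := by
  have := (Real.GammaIntegral_convergent (s := s + i + 1) (by have : (0:ℝ) ≤ i := by positivity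
                                                              linarith)).div_const (Nat.factorial i : ℝ)
  refine IntegrableOn.congr_fun this (fun u (hu : 0 < u) => ?_) measurableSet_Ioi
  simp only [gd]
  rw [show s + i + 1 - 1 = s + i by ring, Real.rpow_add hu, Real.rpow_natCast]; ring

lemma gd_rpow_integral (i : ℕ) {s : ℝ} (hs : -1 < s) :
    ∫ u in Ioi (0:ℝ), u ^ s * gd i u = Real.Gamma (s + i + 1) / (Nat.factorial i : ℝ) := by
  have : (0:ℝ) ≤ i := by positivity
  rw [Real.Gamma_eq_integral (by linarith), ← integral_div]
  refine setIntegral_congr_fun measurableSet_Ioi fun u (hu : 0 < u) => ?_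
  simp only [gd]
  rw [show s + i + 1 - 1 = s + i by ring, Real.rpow_add hu, Real.rpow_natCast]; ring

lemma abs_log_le {u : ℝ} (hu : 0 < u) : |Real.log u| ≤ u ^ (1:ℝ) + 2 * u ^ (-(1/2):ℝ) := by
  have h1 := Real.log_le_self hu.le
  have h2 := Real.log_le_self (Real.rpow_pos_of_pos hu (-(1/2):ℝ)).le
  rw [Real.log_rpow hu] at h2
  have h3 := Real.rpow_pos_of_pos hu (-(1/2):ℝ)
  rw [abs_le, Real.rpow_one]; constructor <;> linarith

lemma gd_meas (i : ℕ) : Measurable (gd i) := by unfold gd; fun_prop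

lemma gd_log_integrable (i : ℕ) : IntegrableOn (fun u => Real.log u * gd i u) (Ioi 0) := by
  refine Integrable.mono' ((gd_rpow_integrable i (s := 1) (by norm_num)).add
    ((gd_rpow_integrable i (s := -(1/2)) (by norm_num)).const_mul 2)) 
    (by have := gd_meas i; fun_prop) ?_
  filter_upwards [self_mem_ae_restrict measurableSet_Ioi] with u (hu : 0 < u)
  rw [norm_mul, Real.norm_eq_abs, Real.norm_of_nonneg (gd_nonneg i hu.le)]
  have := mul_le_mul_of_nonneg_right (abs_log_le hu) (gd_nonneg i hu.le)
  simp only [Pi.add_apply]; linarith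

lemma gd_integrable (i : ℕ) : IntegrableOn (gd i) (Ioi 0) := by
  simpa using gd_rpow_integrable i (s := 0) (by norm_num)

lemma gd_integral (i : ℕ) : ∫ u in Ioi (0:ℝ), gd i u = 1 := by
  have := gd_rpow_integral i (s := 0) (by norm_num)
  simp only [Real.rpow_zero, one_mul, zero_add, Real.Gamma_nat_eq_factorial] at this
  rw [this]; field_simp

/-- scaled versions -/
lemma sgd_rpow_integrable (i : ℕ) {s a : ℝ} (hs : -1 < s) (ha : 0 < a) :
    IntegrableOn (fun y => y ^ s * (a * gd i (a * y))) (Ioi 0) := by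
  have := (integrableOn_Ioi_comp_mul_left_iff (fun u => u ^ s * gd i u) 0 ha).2
    (by simpa using gd_rpow_integrable i hs)
  refine IntegrableOn.congr_fun (this.const_mul (a ^ (-s) * a)) (fun y (hy : 0 < y) => ?_) measurableSet_Ioi
  rw [Real.mul_rpow ha.le hy.le]
  have : a ^ (-s) * a ^ s = 1 := by rw [← Real.rpow_add ha]; simp
  linear_combination (a * y ^ s * gd i (a*y)) * this

lemma sgd_rpow_integral (i : ℕ) {s a : ℝ} (hs : -1 < s) (ha : 0 < a) :
    ∫ y in Ioi (0:ℝ), y ^ s * (a * gd i (a * y)) =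
      a ^ (-s) * (Real.Gamma (s + i + 1) / (Nat.factorial i : ℝ)) := by
  have := integral_comp_mul_left_Ioi (fun u => u ^ s * gd i u) 0 ha
  rw [mul_zero, gd_rpow_integral i hs, smul_eq_mul] at this
  have h2 : ∫ y in Ioi (0:ℝ), y ^ s * (a * gd i (a * y)) =
     ∫ y in Ioi (0:ℝ), (a ^ (-s) * a) * ((a * y) ^ s * gd i (a * y)) := by
    refine setIntegral_congr_fun measurableSet_Ioi (fun y (hy : 0 < y) => ?_)
    rw [Real.mul_rpow ha.le hy.le]
    have : a ^ (-s) * a ^ s = 1 := by rw [← Real.rpow_add ha]; simp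
    linear_combination -(a * y ^ s * gd i (a*y)) * this
  rw [h2, integral_const_mul, this]; field_simp

lemma sgd_log_integral (i : ℕ) {a : ℝ} (ha : 0 < a) :
    ∫ y in Ioi (0:ℝ), Real.log y * (a * gd i (a * y)) =
      harmonicR i - Real.eulerMascheroniConstant - Real.log a := by
  have := integral_comp_mul_left_Ioi (fun u => Real.log u * gd i u - Real.log a * gd i u) 0 ha
  rw [mul_zero, integral_sub (gd_log_integrable i) ((gd_integrable i).const_mul _),
    integral_const_mul, gd_integral] at this
  have h0 := integral_log_gamma i
  change ∫ u in Ioi (0:ℝ), Real.log u * gd i u = _ at h0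
  rw [h0] at this
  have h2 : ∫ y in Ioi (0:ℝ), Real.log y * (a * gd i (a * y)) =
     ∫ y in Ioi (0:ℝ), a * (Real.log (a * y) * gd i (a * y) - Real.log a * gd i (a * y)) := by
    refine setIntegral_congr_fun measurableSet_Ioi (fun y (hy : 0 < y) => ?_)
    rw [Real.log_mul ha.ne' hy.ne']; ring
  rw [h2, integral_const_mul, this, smul_eq_mul]; field_simp

lemma gamma_half_le (i : ℕ) :
    Real.Gamma (-(1/2) + i + 1) / (Nat.factorial i : ℝ) ≤ Real.Gamma (1/2) := by
  induction i with
  | zero => norm_num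
  | succ n ih =>
    have h : Real.Gamma (-(1/2) + (n+1:ℕ) + 1) = (-(1/2) + n + 1) * Real.Gamma (-(1/2) + n + 1) := by
      rw [← Real.Gamma_add_one (by have : (0:ℝ) ≤ n := by positivity
                                   linarith)]
      push_cast; ring_nf
    have hp : 0 < Real.Gamma (-(1/2) + n + 1) := Real.Gamma_pos_of_pos (by
      have : (0:ℝ) ≤ n := by positivity
      linarith)
    refine le_trans ?_ ih
    rw [h, Nat.factorial_succ, div_le_div_iff₀ (by positivity) (by positivity)]
    push_cast
    have : (0:ℝ) < (Nat.factorial n : ℝ) := by positivity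
    nlinarith [mul_pos hp this]

lemma integrableOn_rpow_exp {a r : ℝ} (ha : 0 < a) (hr : 0 < r) :
    IntegrableOn (fun t : ℝ => t ^ (a - 1) * Real.exp (-(r * t))) (Ioi 0) := by
  have := sgd_rpow_integrable 0 (s := a - 1) (a := r) (by linarith) hr
  refine IntegrableOn.congr_fun (this.const_mul r⁻¹) (fun y (hy : 0 < y) => ?_) measurableSet_Ioi
  simp only [gd, pow_zero, Nat.factorial_zero]
  field_simp; simp

/-- Kummer transformation in integral form. -/
lemma kummerU_eq {m z : ℝ} (hm : 0 < m) (hz : 0 < z) (i : ℕ) :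
    Real.Gamma (m + 1) * kummerU (m + i) i z =
      ∫ x in Ioi (0:ℝ), x ^ m * Real.exp (-x) * (1 / (x + z)) ^ (m + i) := by
  have hmi : 0 < m + i := by positivity
  let μ : Measure ℝ := volume.restrict (Ioi 0)
  let K : ℝ → ℝ → ℝ := fun t s =>
    (t ^ (m + i - 1) * Real.exp (-(z * t))) * (s ^ (m + 1 - 1) * Real.exp (-((1 + t) * s)))
  have hK : Integrable (Function.uncurry K) (μ.prod μ) := by
    have h1 : Integrable (fun t : ℝ => t ^ (m + i - 1) * Real.exp (-(z * t))) μ :=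
      integrableOn_rpow_exp hmi hz
    have h2 : Integrable (fun t : ℝ => t ^ (m + 1 - 1) * Real.exp (-(1 * t))) μ :=
      integrableOn_rpow_exp (by linarith) one_pos
    refine (h1.mul_prod h2).mono' ?_ ?_
    · refine Measurable.aestronglyMeasurable ?_
      unfold K Function.uncurry; fun_prop
    · have : ∀ᵐ p : ℝ × ℝ ∂(μ.prod μ), p ∈ Ioi (0:ℝ) ×ˢ Ioi (0:ℝ) := by
        unfold μ
        rw [Measure.prod_restrict]
        exact self_mem_ae_restrict (measurableSet_Ioi.prod measurableSet_Ioi)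
      filter_upwards [this] with p hp
      obtain ⟨hp1, hp2⟩ := hp
      simp only [mem_Ioi] at hp1 hp2
      simp only [K, Function.uncurry]
      rw [Real.norm_of_nonneg (by positivity)]
      have : Real.exp (-((1 + p.1) * p.2)) ≤ Real.exp (-(1 * p.2)) := by
        apply Real.exp_le_exp.2; nlinarith [mul_pos hp1 hp2]
      gcongr
  have hsw := integral_integral_swap hK
  have hL : ∫ t, ∫ s, K t s ∂μ ∂μ = Real.Gamma (m+1) *
      ∫ t in Ioi (0 : ℝ), Real.exp (-z * t) * t ^ (m + i - 1) * (1 + t) ^ (i - (m + i) - 1) := by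
    rw [← integral_const_mul]
    refine setIntegral_congr_fun measurableSet_Ioi fun t (ht : 0 < t) => ?_
    simp only [K]
    rw [integral_const_mul, Real.integral_rpow_mul_exp_neg_mul_Ioi (by linarith) (by linarith),
      one_div, Real.inv_rpow (by linarith), ← Real.rpow_neg (by linarith)]
    rw [show (i:ℝ) - (m + i) - 1 = -(m+1) by ring, neg_mul]; ring
  have hR : ∫ s, ∫ t, K t s ∂μ ∂μ = Real.Gamma (m + i) *
      ∫ x in Ioi (0:ℝ), x ^ m * Real.exp (-x) * (1 / (x + z)) ^ (m + i) := by
    rw [← integral_const_mul]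
    refine setIntegral_congr_fun measurableSet_Ioi fun s (hs : 0 < s) => ?_
    simp only [K]
    have : ∀ t : ℝ, t ^ (m + i - 1) * Real.exp (-(z * t)) * 
        (s ^ (m + 1 - 1) * Real.exp (-((1 + t) * s))) =
        (s ^ m * Real.exp (-s)) * (t ^ (m + i - 1) * Real.exp (-((s + z) * t))) := by
      intro t
      have e : Real.exp (-(z * t)) * Real.exp (-((1 + t) * s)) = 
        Real.exp (-s) * Real.exp (-((s + z) * t)) := by
        rw [← Real.exp_add, ← Real.exp_add]; ring_nf
      rw [show m + 1 - 1 = m by ring]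
      linear_combination (t ^ (m + i - 1) * s ^ m) * e
    simp only [this]
    rw [integral_const_mul, Real.integral_rpow_mul_exp_neg_mul_Ioi hmi (by linarith)]
    ring
  rw [hL, hR] at hsw
  have hG := Real.Gamma_pos_of_pos hmi
  unfold kummerU
  rw [mul_left_comm, hsw]; field_simp

/-- negative binomial weights times the exponential density -/
noncomputable def wP (m z : ℝ) (i : ℕ) (x : ℝ) : ℝ :=
  poch m i / (Nat.factorial i : ℝ) * (x / (x + z)) ^ m * (z / (x + z)) ^ i * Real.exp (-x)

lemma wP_meas (m z : ℝ) (i : ℕ) : Measurable (wP m z i) := by unfold wP; fun_prop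

lemma wP_nonneg {m z : ℝ} (hm : 0 < m) (hz : 0 < z) (i : ℕ) {x : ℝ} (hx : 0 < x) :
    0 ≤ wP m z i x := by
  have := poch_pos hm i
  unfold wP; positivity

lemma wP_integral {m z : ℝ} (hm : 0 < m) (hz : 0 < z) (i : ℕ) :
    ∫ x in Ioi (0:ℝ), wP m z i x = poch m i / (Nat.factorial i : ℝ) * z ^ i *
      (Real.Gamma (m + 1) * kummerU (m + i) i z) := by
  rw [kummerU_eq hm hz, ← integral_const_mul]
  refine setIntegral_congr_fun measurableSet_Ioi fun x (hx : 0 < x) => ?_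
  have hxz : 0 < x + z := by linarith
  simp only [wP]
  rw [Real.rpow_add (by positivity), Real.rpow_natCast, div_eq_mul_one_div x,
    Real.mul_rpow hx.le (by positivity), div_eq_mul_one_div z, mul_pow]
  ring

lemma wP_hasSum {m z : ℝ} (hz : 0 < z) {x : ℝ} (hx : 0 < x) :
    HasSum (fun i => wP m z i x) (Real.exp (-x)) := by
  have hxz : 0 < x + z := by linarith
  have h := negbin m (q := z / (x + z)) (by positivity) (by rw [div_lt_one hxz]; linarith)
  have e : 1 - z / (x + z) = x / (x + z) := by field_simp; ring
  rw [e] at h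
  have h2 := h.mul_left ((x / (x + z)) ^ m * Real.exp (-x))
  have hp : 0 < (x / (x + z)) ^ m := by positivity
  have e1 : (x / (x + z)) ^ m * Real.exp (-x) * ((x / (x + z)) ^ m)⁻¹ = Real.exp (-x) := by
    field_simp
  rw [e1] at h2
  have e2 : (fun i => wP m z i x) = fun i : ℕ => (x / (x + z)) ^ m * Real.exp (-x) *
      (poch m i / (Nat.factorial i : ℝ) * (z / (x + z)) ^ i) := by
    funext i; simp only [wP]; ring
  rw [e2]; exact h2

lemma wP_shift_le {m z : ℝ} (hm : 0 < m) (hz : 0 < z) (i : ℕ) {x : ℝ} (hx : 0 < x) :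
    x * (((i:ℝ) + 1) * wP m z i x) ≤ (1 + m) * ((x + z) * wP (m + 1) z i x) := by
  have hxz : 0 < x + z := by linarith
  have h1 := poch_shift m i
  have hp := poch_pos hm i
  have e : (x + z) * wP (m+1) z i x = x * (poch (m+1) i / (Nat.factorial i : ℝ) * (x / (x + z)) ^ m * (z / (x + z)) ^ i * Real.exp (-x)) := by
    unfold wP
    rw [Real.rpow_add_one (by positivity)]; field_simp
  rw [e]
  have h3 : ((i:ℝ) + 1) * poch m i ≤ (1 + m) * poch (m+1) i := by
    have : m * (((i:ℝ) + 1) * poch m i) ≤ m * ((1 + m) * poch (m+1) i) := by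
      have : m * ((1 + m) * poch (m+1) i) = (1+m) * (poch m i * (m + i)) := by rw [← h1]; ring
      rw [this]
      have hi : (0:ℝ) ≤ i := by positivity
      nlinarith [mul_pos hm hp, mul_nonneg hi hp.le, mul_nonneg hp.le (sq_nonneg m)]
    exact le_of_mul_le_mul_left this hm
  unfold wP
  have hQ : 0 ≤ x * ((x / (x + z)) ^ m * (z / (x + z)) ^ i * Real.exp (-x) / (Nat.factorial i : ℝ)) := by positivity
  have := mul_le_mul_of_nonneg_right h3 hQ
  calc _ = _ := ?_
    _ ≤ _ := this
    _ = _ := ?_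
  · ring
  · ring

lemma integrable_prod_count {W : ℝ × ℕ → ℝ} {S : ℝ → ℝ} (hW : ∀ i, Measurable fun x => W (x, i))
    (h0 : ∀ x, 0 < x → ∀ i, 0 ≤ W (x, i)) (hS : ∀ x, 0 < x → HasSum (fun i => W (x, i)) (S x))
    (hI : IntegrableOn S (Ioi 0)) :
    Integrable W ((volume.restrict (Ioi (0:ℝ))).prod Measure.count) := by
  have hm : Measurable W := measurable_from_prod_countable_left hW
  have key : ∀ x, 0 < x → Integrable (fun i => W (x, i)) Measure.count := by
    intro x hx
    rw [integrable_count_iff]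
    simpa [abs_of_nonneg (h0 x hx _)] using (hS x hx).summable
  rw [integrable_prod_iff hm.aestronglyMeasurable]
  constructor
  · filter_upwards [self_mem_ae_restrict measurableSet_Ioi] with x hx using key x hx
  · refine IntegrableOn.congr_fun hI (fun x (hx : 0 < x) => ?_) measurableSet_Ioi
    rw [integral_countable (key x hx).norm, ← (hS x hx).tsum_eq]
    simp [Measure.real, abs_of_nonneg (h0 x hx _)]

lemma integrable_triple {m z c s : ℝ} (hm : 0 < m) (hz : 0 < z) (hc : 0 < c) (hs : -1 < s)
    (hW : Integrable (fun p : ℝ × ℕ => (c / p.1) ^ (-s) *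
        (Real.Gamma (s + p.2 + 1) / (Nat.factorial p.2 : ℝ)) * wP m z p.2 p.1)
        ((volume.restrict (Ioi (0:ℝ))).prod Measure.count)) :
    Integrable (fun q : ℝ × (ℝ × ℕ) =>
      q.1 ^ s * (c / q.2.1 * gd q.2.2 (c / q.2.1 * q.1)) * wP m z q.2.2 q.2.1)
      ((volume.restrict (Ioi (0:ℝ))).prod ((volume.restrict (Ioi (0:ℝ))).prod Measure.count)) := by
  have hmeas : Measurable (fun q : ℝ × (ℝ × ℕ) =>
      q.1 ^ s * (c / q.2.1 * gd q.2.2 (c / q.2.1 * q.1)) * wP m z q.2.2 q.2.1) := by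
    have : Measurable (fun r : (ℝ × ℝ) × ℕ =>
      r.1.1 ^ s * (c / r.1.2 * gd r.2 (c / r.1.2 * r.1.1)) * wP m z r.2 r.1.2) := by
      refine measurable_from_prod_countable_left fun i => ?_
      have := gd_meas i
      have := wP_meas m z i
      dsimp only
      fun_prop
    exact this.comp (by fun_prop : Measurable fun q : ℝ × (ℝ × ℕ) => ((q.1, q.2.1), q.2.2))
  have hpos : ∀ᵐ p : ℝ × ℕ ∂((volume.restrict (Ioi (0:ℝ))).prod Measure.count), 0 < p.1 := by
    have := Measure.quasiMeasurePreserving_fst (μ := volume.restrict (Ioi (0:ℝ)))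
      (ν := (Measure.count : Measure ℕ))
    exact this.ae (self_mem_ae_restrict measurableSet_Ioi)
  rw [integrable_prod_iff' hmeas.aestronglyMeasurable]
  constructor
  · filter_upwards [hpos] with p hp
    exact (sgd_rpow_integrable p.2 hs (by positivity)).mul_const _
  · refine hW.congr ?_
    filter_upwards [hpos] with p hp
    rw [← sgd_rpow_integral p.2 hs (by positivity), ← integral_mul_const]
    refine setIntegral_congr_fun measurableSet_Ioi fun y (hy : 0 < y) => ?_
    have h1 := gd_nonneg p.2 (u := c / p.1 * y) (by positivity)
    have h2 := wP_nonneg hm hz p.2 hp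
    rw [Real.norm_of_nonneg (by positivity)]

lemma condPdf_eq {m k γb : ℝ} (hm : 0 < m) (hγb : 0 < γb) (hk : 0 < k) {x : ℝ} (hx : 0 < x)
    (y : ℝ) :
    condPdf m k γb x y * Real.exp (-x) = ∑' i : ℕ,
      ((k + 1) / γb / x * gd i ((k + 1) / γb / x * y)) * wP m (k / m) i x := by
  unfold condPdf kummerM
  rw [← tsum_mul_left, ← tsum_mul_right]
  congr 1; ext i
  have h1 : (1 + k / x) / ((k + x) / (k + 1) * γb) = (k + 1) / γb / x := by field_simp; ring
  have h2 : (k / x) * (1 + k / x) / (k / x + m) * (y / ((k + x) / (k + 1) * γb)) =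
    (k / m) / (x + k / m) * ((k + 1) / γb / x * y) := by field_simp; ring
  have h3 : (m ^ m * (1 + k / x)) / ((m + k / x) ^ m * ((k + x) / (k + 1) * γb)) =
    (x / (x + k / m)) ^ m * ((k + 1) / γb / x) := by
    rw [mul_div_mul_comm, h1, ← Real.div_rpow (by positivity) (by positivity)]
    congr 2; field_simp
  rw [h1, h2, h3]
  unfold gd wP
  rw [mul_pow, neg_mul]
  field_simp

lemma integral_count_eq {f : ℕ → ℝ} (hf : Integrable f Measure.count) :
    ∫ i, f i ∂Measure.count = ∑' i, f i := by
  rw [integral_countable hf]; simp [Measure.real]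

lemma exp_integrable : IntegrableOn (fun x : ℝ => Real.exp (-x)) (Ioi 0) := by
  simpa using integrableOn_rpow_exp (a := 1) (r := 1) one_pos one_pos

lemma exp_log_integrable : IntegrableOn (fun x : ℝ => Real.log x * Real.exp (-x)) (Ioi 0) := by
  simpa [gd] using gd_log_integrable 0

lemma integrable_one {m z c : ℝ} (hm : 0 < m) (hz : 0 < z) (hc : 0 < c) :
    Integrable (fun p : ℝ × ℕ => (c / p.1) ^ (-(1:ℝ)) *
        (Real.Gamma (1 + p.2 + 1) / (Nat.factorial p.2 : ℝ)) * wP m z p.2 p.1)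
        ((volume.restrict (Ioi (0:ℝ))).prod Measure.count) := by
  have hdom : Integrable (fun p : ℝ × ℕ => c⁻¹ * ((1 + m) * ((p.1 + z) * wP (m + 1) z p.2 p.1)))
      ((volume.restrict (Ioi (0:ℝ))).prod Measure.count) := by
    refine integrable_prod_count (S := fun x => c⁻¹ * ((1 + m) * ((x + z) * Real.exp (-x))))
      (fun i => ?_) (fun x hx i => ?_) (fun x hx => ?_) ?_
    · have := wP_meas (m+1) z i
      dsimp only; fun_prop
    · have := wP_nonneg (m := m + 1) (by linarith) hz i hx
      dsimp only; positivity
    · exact (((wP_hasSum hz hx).mul_left _).mul_left _).mul_left _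
    · refine Integrable.const_mul (Integrable.const_mul ?_ _) _
      have h1 := integrableOn_rpow_exp (a := 2) (r := 1) two_pos one_pos
      refine Integrable.congr (Integrable.add h1 (exp_integrable.const_mul z)) ?_
      refine Filter.Eventually.of_forall fun x => ?_
      simp only [Pi.add_apply, one_mul]
      rw [show (2:ℝ) - 1 = 1 by norm_num, Real.rpow_one]; ring
  refine hdom.mono' ?_ ?_
  · refine (measurable_from_prod_countable_left fun i => ?_).aestronglyMeasurable
    have := wP_meas m z i
    dsimp only; fun_prop
  · have := Measure.quasiMeasurePreserving_fst (μ := volume.restrict (Ioi (0:ℝ)))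
      (ν := (Measure.count : Measure ℕ))
    filter_upwards [this.ae (self_mem_ae_restrict measurableSet_Ioi)] with p (hp : 0 < p.1)
    have h2 := wP_nonneg hm hz p.2 hp
    have h3 := wP_shift_le hm hz p.2 hp
    have e : Real.Gamma (1 + p.2 + 1) / (Nat.factorial p.2 : ℝ) = p.2 + 1 := by
      rw [show (1:ℝ) + p.2 + 1 = ((p.2 + 1 : ℕ) : ℝ) + 1 by push_cast; ring,
        Real.Gamma_nat_eq_factorial, Nat.factorial_succ]
      push_cast; field_simp
    rw [e, Real.rpow_neg (by positivity), Real.rpow_one, Real.norm_of_nonneg (by positivity)]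
    calc _ = c⁻¹ * (p.1 * (((p.2:ℝ) + 1) * wP m z p.2 p.1)) := by rw [inv_div]; ring
      _ ≤ _ := by gcongr

lemma integrable_half {m z c : ℝ} (hm : 0 < m) (hz : 0 < z) (hc : 0 < c) :
    Integrable (fun p : ℝ × ℕ => (c / p.1) ^ (-(-(1/2):ℝ)) *
        (Real.Gamma (-(1/2) + p.2 + 1) / (Nat.factorial p.2 : ℝ)) * wP m z p.2 p.1)
        ((volume.restrict (Ioi (0:ℝ))).prod Measure.count) := by
  have hdom : Integrable (fun p : ℝ × ℕ => (c / p.1) ^ (-(-(1/2):ℝ)) * Real.Gamma (1/2) *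
      wP m z p.2 p.1)
      ((volume.restrict (Ioi (0:ℝ))).prod Measure.count) := by
    refine integrable_prod_count (S := fun x => (c / x) ^ (-(-(1/2):ℝ)) * Real.Gamma (1/2) *
      Real.exp (-x))
      (fun i => ?_) (fun x hx i => ?_) (fun x hx => ?_) ?_
    · have := wP_meas m z i
      dsimp only; fun_prop
    · have := wP_nonneg hm hz i hx
      have := Real.Gamma_pos_of_pos (s := 1/2) (by norm_num)
      dsimp only; positivity
    · exact (wP_hasSum hz hx).mul_left _
    · have h1 := integrableOn_rpow_exp (a := 1/2) (r := 1) (by norm_num) one_pos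
      refine IntegrableOn.congr_fun (h1.const_mul (c ^ (1/2:ℝ) * Real.Gamma (1/2)))
        (fun x (hx : 0 < x) => ?_) measurableSet_Ioi
      simp only [one_mul, neg_neg]
      rw [Real.div_rpow hc.le hx.le, show (1/2:ℝ) - 1 = -(1/2) by norm_num, Real.rpow_neg hx.le]
      ring
  refine hdom.mono' ?_ ?_
  · refine (measurable_from_prod_countable_left fun i => ?_).aestronglyMeasurable
    have := wP_meas m z i
    dsimp only; fun_prop
  · have := Measure.quasiMeasurePreserving_fst (μ := volume.restrict (Ioi (0:ℝ)))
      (ν := (Measure.count : Measure ℕ))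
    filter_upwards [this.ae (self_mem_ae_restrict measurableSet_Ioi)] with p (hp : 0 < p.1)
    have h2 := wP_nonneg hm hz p.2 hp
    have h3 := gamma_half_le p.2
    have hG : 0 < Real.Gamma (-(1/2) + p.2 + 1) := Real.Gamma_pos_of_pos (by
      have : (0:ℝ) ≤ p.2 := by positivity
      linarith)
    rw [Real.norm_of_nonneg (by positivity)]
    gcongr

lemma integrable_log_triple {m z c : ℝ} (hm : 0 < m) (hz : 0 < z) (hc : 0 < c) :
    Integrable (fun q : ℝ × (ℝ × ℕ) =>
      Real.log q.1 * (c / q.2.1 * gd q.2.2 (c / q.2.1 * q.1)) * wP m z q.2.2 q.2.1)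
      ((volume.restrict (Ioi (0:ℝ))).prod ((volume.restrict (Ioi (0:ℝ))).prod Measure.count)) := by
  have i1 := integrable_triple hm hz hc (s := 1) (by norm_num) (integrable_one hm hz hc)
  have i2 := integrable_triple hm hz hc (s := -(1/2)) (by norm_num) (integrable_half hm hz hc)
  refine (i1.add (i2.const_mul 2)).mono' ?_ ?_
  · have : Measurable (fun r : (ℝ × ℝ) × ℕ =>
      Real.log r.1.1 * (c / r.1.2 * gd r.2 (c / r.1.2 * r.1.1)) * wP m z r.2 r.1.2) := by
      refine measurable_from_prod_countable_left fun i => ?_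
      have := gd_meas i
      have := wP_meas m z i
      dsimp only
      fun_prop
    exact (this.comp (by fun_prop :
      Measurable fun q : ℝ × (ℝ × ℕ) => ((q.1, q.2.1), q.2.2))).aestronglyMeasurable
  · have h1 := Measure.quasiMeasurePreserving_fst (μ := volume.restrict (Ioi (0:ℝ)))
      (ν := ((volume.restrict (Ioi (0:ℝ))).prod (Measure.count : Measure ℕ)))
    have h2 := (Measure.quasiMeasurePreserving_fst (μ := volume.restrict (Ioi (0:ℝ)))
      (ν := (Measure.count : Measure ℕ))).comp
      (Measure.quasiMeasurePreserving_snd (μ := volume.restrict (Ioi (0:ℝ)))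
      (ν := ((volume.restrict (Ioi (0:ℝ))).prod (Measure.count : Measure ℕ))))
    filter_upwards [h1.ae (self_mem_ae_restrict measurableSet_Ioi),
      h2.ae (self_mem_ae_restrict measurableSet_Ioi)] with q (hq1 : 0 < q.1) (hq2 : 0 < q.2.1)
    have a1 := wP_nonneg hm hz q.2.2 hq2
    have a2 := gd_nonneg q.2.2 (u := c / q.2.1 * q.1) (by positivity)
    have a3 : 0 ≤ (c / q.2.1 * gd q.2.2 (c / q.2.1 * q.1)) * wP m z q.2.2 q.2.1 := by positivity
    rw [mul_assoc, norm_mul, Real.norm_of_nonneg a3, Real.norm_eq_abs]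
    have := mul_le_mul_of_nonneg_right (abs_log_le hq1) a3
    simp only [Pi.add_apply]; linarith

lemma log_exp_integral : ∫ x in Ioi (0:ℝ), Real.log x * Real.exp (-x) =
    -Real.eulerMascheroniConstant := by
  have := integral_log_gamma 0
  simpa [harmonicR] using this

lemma main_ln {m k γb : ℝ} (hm : 0 < m) (hγb : 0 < γb) (hk : 0 < k) :
    ∫ y in Ioi (0 : ℝ), Real.log y * pdfSNR m k γb y =
      Real.log (γb / (k + 1)) - 2 * Real.eulerMascheroniConstant +
        Real.Gamma (m + 1) *
          ∑' i : ℕ, poch m i / (Nat.factorial i : ℝ) * (k / m) ^ i * harmonicR i *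
            kummerU (m + i) i (k / m) := by
  obtain ⟨z, hzd⟩ : ∃ z, z = k / m := ⟨_, rfl⟩
  obtain ⟨c, hcd⟩ : ∃ c, c = (k + 1) / γb := ⟨_, rfl⟩
  have hz : 0 < z := by rw [hzd]; positivity
  have hc : 0 < c := by rw [hcd]; positivity
  have hI := integrable_log_triple hm hz hc
  set E := Real.eulerMascheroniConstant
  let μ : Measure ℝ := volume.restrict (Ioi 0)
  let Φ : ℝ → ℝ × ℕ → ℝ := fun y p =>
      Real.log y * (c / p.1 * gd p.2 (c / p.1 * y)) * wP m z p.2 p.1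
  have hI' : Integrable (Function.uncurry Φ) (μ.prod (μ.prod Measure.count)) := hI
  have hpos : ∀ᵐ p : ℝ × ℕ ∂(μ.prod Measure.count), 0 < p.1 :=
    (Measure.quasiMeasurePreserving_fst (μ := μ)
      (ν := (Measure.count : Measure ℕ))).ae (self_mem_ae_restrict measurableSet_Ioi)
  have s1 : ∫ y in Ioi (0 : ℝ), Real.log y * pdfSNR m k γb y =
      ∫ y, ∫ p, Φ y p ∂(μ.prod Measure.count) ∂μ := by
    refine integral_congr_ae ?_
    filter_upwards [hI'.prod_right_ae] with y hy
    have hy' : Integrable (fun p => Φ y p) (μ.prod Measure.count) := hy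
    rw [integral_prod _ hy']
    unfold pdfSNR
    rw [← integral_const_mul]
    refine integral_congr_ae ?_
    filter_upwards [hy'.prod_right_ae, self_mem_ae_restrict measurableSet_Ioi] with x hx1 (hx : 0 < x)
    rw [integral_count_eq hx1, condPdf_eq hm hγb hk hx, ← tsum_mul_left, ← hzd, ← hcd]
    simp only [Φ, mul_assoc]
  have s2 : ∀ p : ℝ × ℕ, 0 < p.1 → ∫ y, Φ y p ∂μ =
      (harmonicR p.2 - E - Real.log (c / p.1)) * wP m z p.2 p.1 := by
    intro p hp
    simp only [Φ]
    rw [integral_mul_const, sgd_log_integral p.2 (by positivity)]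
  have hG : Integrable (fun p : ℝ × ℕ => (harmonicR p.2 - E - Real.log (c / p.1)) * wP m z p.2 p.1)
      (μ.prod Measure.count) := by
    refine hI'.integral_prod_right.congr ?_
    filter_upwards [hpos] with p hp using s2 p hp
  -- the part without harmonic numbers
  have hB : Integrable (fun p : ℝ × ℕ => wP m z p.2 p.1) (μ.prod Measure.count) := 
    integrable_prod_count (fun i => wP_meas m z i) (fun x hx i => wP_nonneg hm hz i hx)
      (fun x hx => wP_hasSum hz hx) exp_integrable
  have hL : Integrable (fun p : ℝ × ℕ => Real.log p.1 * wP m z p.2 p.1) (μ.prod Measure.count) := by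
    have : Integrable (fun p : ℝ × ℕ => |Real.log p.1| * wP m z p.2 p.1) (μ.prod Measure.count) := by
      refine integrable_prod_count (S := fun x => |Real.log x| * Real.exp (-x)) (fun i => ?_)
        (fun x hx i => mul_nonneg (abs_nonneg _) (wP_nonneg hm hz i hx))
        (fun x hx => (wP_hasSum hz hx).mul_left _) ?_
      · have := wP_meas m z i
        have h2 := Real.measurable_log.abs
        exact h2.mul this
      · have := exp_log_integrable.norm
        simp only [norm_mul, Real.norm_eq_abs, Real.abs_exp] at this
        exact this
    refine this.mono' ?_ ?_
    · refine (measurable_from_prod_countable_left fun i => ?_).aestronglyMeasurable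
      have := wP_meas m z i
      dsimp only; fun_prop
    · filter_upwards [hpos] with p hp
      rw [norm_mul, Real.norm_eq_abs, Real.norm_of_nonneg (wP_nonneg hm hz p.2 hp)]
  have hH : Integrable (fun p : ℝ × ℕ => harmonicR p.2 * wP m z p.2 p.1) (μ.prod Measure.count) := by
    refine ((hG.add (hB.const_mul (E + Real.log c))).sub hL).congr ?_
    filter_upwards [hpos] with p hp
    simp only [Pi.add_apply, Pi.sub_apply]
    rw [Real.log_div hc.ne' hp.ne']; ring
  have eB : ∫ p : ℝ × ℕ, wP m z p.2 p.1 ∂(μ.prod Measure.count) = 1 := by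
    rw [integral_prod _ hB, ← gd_integral 0]
    refine integral_congr_ae ?_
    filter_upwards [hB.prod_right_ae, self_mem_ae_restrict measurableSet_Ioi] with x hx1 (hx : 0 < x)
    rw [integral_count_eq hx1, (wP_hasSum hz hx).tsum_eq]; simp [gd]
  have eL : ∫ p : ℝ × ℕ, Real.log p.1 * wP m z p.2 p.1 ∂(μ.prod Measure.count) = -E := by
    rw [integral_prod _ hL, ← log_exp_integral]
    refine integral_congr_ae ?_
    filter_upwards [hL.prod_right_ae, self_mem_ae_restrict measurableSet_Ioi] with x hx1 (hx : 0 < x)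
    rw [integral_count_eq hx1]
    rw [((wP_hasSum hz hx).mul_left _).tsum_eq]
  have eH : ∫ p : ℝ × ℕ, harmonicR p.2 * wP m z p.2 p.1 ∂(μ.prod Measure.count) =
      Real.Gamma (m + 1) *
          ∑' i : ℕ, poch m i / (Nat.factorial i : ℝ) * z ^ i * harmonicR i *
            kummerU (m + i) i z := by
    rw [integral_prod_symm _ hH, integral_count_eq hH.integral_prod_right, ← tsum_mul_left]
    congr 1; ext i
    simp only
    rw [integral_const_mul]
    unfold μ
    rw [wP_integral hm hz]; ring
  rw [s1, integral_integral_swap hI']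
  have s3 : ∫ p, ∫ y, Φ y p ∂μ ∂(μ.prod Measure.count) =
      ∫ p : ℝ × ℕ, (harmonicR p.2 * wP m z p.2 p.1 - (E + Real.log c) * wP m z p.2 p.1
        + Real.log p.1 * wP m z p.2 p.1) ∂(μ.prod Measure.count) := by
    refine integral_congr_ae ?_
    filter_upwards [hpos] with p hp
    rw [s2 p hp, Real.log_div hc.ne' hp.ne']; ring
  have hD : Integrable (fun p : ℝ × ℕ => harmonicR p.2 * wP m z p.2 p.1 -
      (E + Real.log c) * wP m z p.2 p.1) (μ.prod Measure.count) := hH.sub (hB.const_mul _)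
  rw [s3, integral_add hD hL, integral_sub hH (hB.const_mul _),
    integral_const_mul, eB, eL, eH, ← hzd]
  have : Real.log (γb / (k + 1)) = - Real.log c := by
    rw [hcd, ← Real.log_inv, inv_div]
  rw [this]; ring

/-- Theorem 4: high-SNR ORA capacity in closed form. For `m > 0`, `γ̄ > 0`, `0 < k < m`:
`∫₀^∞ log₂(γ) f(γ) dγ = log₂(γ̄/(k+1)) − 2γ_E/ln 2
  + (Γ(m+1)/ln 2) ∑_i ((m)_i/i!) (k/m)^i H_i U(m+i, i, k/m)`. -/
theorem ora_highSNR_closed_form (m k γb : ℝ) (hm : 0 < m) (hγb : 0 < γb)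
    (hk : 0 < k) (hkm : k < m) :
    ∫ γ in Ioi (0 : ℝ), Real.logb 2 γ * pdfSNR m k γb γ =
      Real.logb 2 (γb / (k + 1)) - 2 * Real.eulerMascheroniConstant / Real.log 2 +
        (Real.Gamma (m + 1) / Real.log 2) *
          ∑' i : ℕ, poch m i / (Nat.factorial i : ℝ) * (k / m) ^ i * harmonicR i *
            kummerU (m + i) i (k / m) := by
  have h := main_ln hm hγb hk
  have e : ∫ γ in Ioi (0 : ℝ), Real.logb 2 γ * pdfSNR m k γb γ =
      (∫ γ in Ioi (0 : ℝ), Real.log γ * pdfSNR m k γb γ) / Real.log 2 := by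
    rw [← integral_div]
    congr 1; ext γ
    rw [Real.logb]; ring
  rw [e, h, Real.logb]; ring
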